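/- For every integer d ≥ 2, the worst-case natural twin-width of posets of width d is Θ(d): it is at least d − 1 for some poset of width d, and at most 9d − 6 for every poset of width d. -/

import Mathlib

/-- All elements of block `B` lie below all elements of block `C`. -/
def blockLE {X : Type*} (le : X → X → Prop) (B C : Finset X) : Prop :=
  ∀ x ∈ B, ∀ y ∈ C, le x y

/-- Two blocks form a red pair (non-homogeneous zone between incomparable blocks):
neither block lies entirely below the other, yet some pair of elements is comparable. -/
def RedPair {X : Type*} (le : X → X → Prop) (B C : Finset X) : Prop :=
  ¬ blockLE le B C ∧ ¬ blockLE le C B ∧ ∃ x ∈ B, ∃ y ∈ C, le x y ∨ le y x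

open Classical in
/-- Red degree of the part `B` in the partition `P`. -/
noncomputable def redDeg {X : Type*} (le : X → X → Prop)
    (P : Finset (Finset X)) (B : Finset X) : ℕ :=
  (P.filter fun C => C ≠ B ∧ RedPair le B C).card

/-- `P` is a partition of the (finite) type `X` into nonempty parts. -/
def IsPartitionOf {X : Type*} (P : Finset (Finset X)) : Prop :=
  (∀ B ∈ P, B.Nonempty) ∧ ∀ x : X, ∃! B, B ∈ P ∧ x ∈ B

/-- `Q` is obtained from `P` by merging (contracting) two of its parts. -/
def MergeStep {X : Type*} [DecidableEq X] (P Q : Finset (Finset X)) : Prop :=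
  ∃ B ∈ P, ∃ C ∈ P, B ≠ C ∧ Q = insert (B ∪ C) ((P.erase B).erase C)

/-- The natural twin-width of the poset `(X, le)` is at most `d`: there is a
contraction sequence from the partition into singletons down to the one-part
partition, merging two parts at each step, whose red degree never exceeds `d`. -/
def NatTwinWidthLE {X : Type*} [Fintype X] [DecidableEq X]
    (le : X → X → Prop) (d : ℕ) : Prop :=
  ∃ (n : ℕ) (seq : Fin (n + 1) → Finset (Finset X)),
    (∀ i, IsPartitionOf (seq i)) ∧
    seq 0 = Finset.univ.image (fun x => ({x} : Finset X)) ∧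
    seq (Fin.last n) = {Finset.univ} ∧
    (∀ i : Fin n, MergeStep (seq i.castSucc) (seq i.succ)) ∧
    ∀ i, ∀ B ∈ seq i, redDeg le (seq i) B ≤ d


theorem dilworth_aux {X : Type*} [DecidableEq X] [PartialOrder X] (m : ℕ) :
    ∀ (S : Finset X) (n : ℕ), S.card ≤ m →
      (∀ A : Finset X, A ⊆ S → IsAntichain (· ≤ ·) (A : Set X) → A.card ≤ n) →
      ∃ c : X → ℕ, (∀ x ∈ S, c x < n) ∧
        ∀ x ∈ S, ∀ y ∈ S, c x = c y → x ≤ y ∨ y ≤ x := by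
  induction m with
  | zero =>
    intro S n hS _
    have : S = ∅ := by simpa using hS
    subst this
    exact ⟨fun _ => 0, by simp, by simp⟩
  | succ m ih =>
    intro S n hS hA
    rcases S.eq_empty_or_nonempty with rfl | hne
    · exact ⟨fun _ => 0, by simp, by simp⟩
    obtain ⟨a, haS, hamax⟩ := S.exists_maximal hne
    have hn : 0 < n := by
      have := hA {a} (by simpa using haS) (by simp)
      simp at this; omega
    -- extending a colouring by one chain
    have key : ∀ K : Finset X, a ∈ K → (∀ x ∈ K, ∀ y ∈ K, x ≤ y ∨ y ≤ x) →
        (∀ A : Finset X, A ⊆ S \ K → IsAntichain (· ≤ ·) (A : Set X) → A.card ≤ n - 1) →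
        ∃ c : X → ℕ, (∀ x ∈ S, c x < n) ∧
        ∀ x ∈ S, ∀ y ∈ S, c x = c y → x ≤ y ∨ y ≤ x := by
      intro K haK hK hAK
      have hcard : (S \ K).card ≤ m := by
        have : (S \ K).card < S.card := by
          apply Finset.card_lt_card
          refine ⟨Finset.sdiff_subset, fun h => ?_⟩
          have := h haS
          simp [haK] at this
        omega
      obtain ⟨c, hc1, hc2⟩ := ih (S \ K) (n - 1) hcard hAK
      refine ⟨fun x => if x ∈ K then n - 1 else c x, ?_, ?_⟩
      · intro x hx
        by_cases hxK : x ∈ K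
        · simp [hxK]; omega
        · have := hc1 x (by simp [hx, hxK])
          simp [hxK]; omega
      · intro x hx y hy hxy
        by_cases hxK : x ∈ K <;> by_cases hyK : y ∈ K <;> simp [hxK, hyK] at hxy
        · exact hK x hxK y hyK
        · have := hc1 y (by simp [hy, hyK]); omega
        · have := hc1 x (by simp [hx, hxK]); omega
        · exact hc2 x (by simp [hx, hxK]) y (by simp [hy, hyK]) hxy
    by_cases hS' : ∀ A : Finset X, A ⊆ S \ {a} → IsAntichain (· ≤ ·) (A : Set X) → A.card ≤ n - 1
    · exact key {a} (by simp) (by simp) hS'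
    push Not at hS'
    obtain ⟨A₀, hA₀S, hA₀, hA₀c⟩ := hS'
    have hcard' : (S \ {a}).card ≤ m := by
      have : (S \ {a}).card < S.card := by
        apply Finset.card_lt_card
        refine ⟨Finset.sdiff_subset, fun h => ?_⟩
        have := h haS
        simp at this
      omega
    obtain ⟨c, hc1, hc2⟩ := ih (S \ {a}) n hcard'
      (fun A hAs hAa => hA A (hAs.trans Finset.sdiff_subset) hAa)
    -- a big antichain
    let Big : Finset X → Prop := fun A => A ⊆ S \ {a} ∧ IsAntichain (· ≤ ·) (A : Set X) ∧ n ≤ A.card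
    have hBig₀ : Big A₀ := ⟨hA₀S, hA₀, by omega⟩
    have hit : ∀ A, Big A → ∀ i < n, ∃ x ∈ A, c x = i := by
      intro A ⟨h1, h2, h3⟩ i hi
      have hinj : Set.InjOn c (A : Set X) := by
        intro x hx y hy hxy
        by_contra hne
        rcases hc2 x (h1 hx) y (h1 hy) hxy with h | h
        · exact h2 hx hy hne h
        · exact h2 hy hx (Ne.symm hne) h
      have himg : A.image c = Finset.range n := by
        apply Finset.eq_of_subset_of_card_le
        · intro j hj
          obtain ⟨x, hx, rfl⟩ := Finset.mem_image.1 hj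
          exact Finset.mem_range.2 (hc1 x (h1 hx))
        · rw [Finset.card_image_of_injOn hinj]; simpa using h3
      have : i ∈ A.image c := by rw [himg]; simpa using hi
      simpa using this
    have hx : ∀ i : ℕ, ∃ x, i < n → x ∈ S \ {a} ∧ c x = i ∧ (∃ A, Big A ∧ x ∈ A) ∧
        ∀ A, Big A → ∀ y ∈ A, c y = i → y ≤ x := by
      intro i
      by_cases hi : i < n
      swap
      · exact ⟨a, fun h => absurd h hi⟩
      classical
      let F := (S \ {a}).filter (fun x => c x = i ∧ ∃ A, Big A ∧ x ∈ A)
      have hF : F.Nonempty := by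
        obtain ⟨x, hxA, hxi⟩ := hit A₀ hBig₀ i hi
        exact ⟨x, Finset.mem_filter.2 ⟨hA₀S hxA, hxi, A₀, hBig₀, hxA⟩⟩
      obtain ⟨x, hxF, hxm⟩ := F.exists_maximal hF
      obtain ⟨h1, h2, h3⟩ := Finset.mem_filter.1 hxF
      refine ⟨x, fun _ => ⟨h1, h2, h3, ?_⟩⟩
      intro A hAB y hy hyi
      have hyS := hAB.1 hy
      rcases hc2 y hyS x h1 (hyi.trans h2.symm) with h | h
      · exact h
      · exact hxm (Finset.mem_filter.2 ⟨hyS, hyi, A, hAB, hy⟩) h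
    choose x hx using hx
    -- the transversal is an antichain
    have hanti : ∀ i < n, ∀ j < n, i ≠ j → ¬ x i ≤ x j := by
      intro i hi j hj hij hle
      obtain ⟨_, hcj, ⟨A, hAB, hjA⟩, _⟩ := hx j hj
      obtain ⟨y, hyA, hyi⟩ := hit A hAB i hi
      have h1 := (hx i hi).2.2.2 A hAB y hyA hyi
      have hne : y ≠ x j := by
        rintro rfl; exact hij (hyi.symm.trans hcj)
      exact hAB.2.1 hyA hjA hne (h1.trans hle)
    have hcomp : ∃ i < n, x i ≤ a := by
      by_contra hcon
      push Not at hcon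
      let A := insert a ((Finset.range n).image x)
      have hinj : Set.InjOn x (Finset.range n : Set ℕ) := by
        intro i hi j hj hij
        by_contra hne
        exact hanti i (by simpa using hi) j (by simpa using hj) hne hij.le
      have hna : a ∉ (Finset.range n).image x := by
        intro h
        obtain ⟨i, hi, h⟩ := Finset.mem_image.1 h
        exact hcon i (by simpa using hi) h.le
      have hcardA : A.card = n + 1 := by
        rw [Finset.card_insert_of_notMem hna, Finset.card_image_of_injOn hinj, Finset.card_range]
      have hle := hA A (by
        intro z hz
        rcases Finset.mem_insert.1 hz with rfl | hz
        · exact haS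
        · obtain ⟨i, hi, rfl⟩ := Finset.mem_image.1 hz
          exact (Finset.mem_sdiff.1 (hx i (by simpa using hi)).1).1) (by
        intro u hu v hv huv hle
        rcases Finset.mem_insert.1 (Finset.mem_coe.1 hu) with rfl | hu' <;>
          rcases Finset.mem_insert.1 (Finset.mem_coe.1 hv) with rfl | hv'
        · exact huv rfl
        · obtain ⟨i, hi, rfl⟩ := Finset.mem_image.1 hv'
          have hi : i < n := by simpa using hi
          exact hcon i hi (hamax (Finset.mem_sdiff.1 (hx i hi).1).1 hle)
        · obtain ⟨i, hi, rfl⟩ := Finset.mem_image.1 hu'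
          exact hcon i (by simpa using hi) hle
        · obtain ⟨i, hi, rfl⟩ := Finset.mem_image.1 hu'
          obtain ⟨j, hj, rfl⟩ := Finset.mem_image.1 hv'
          exact hanti i (by simpa using hi) j (by simpa using hj) (fun h => huv (by rw [h])) hle)
      omega
    obtain ⟨i, hi, hia⟩ := hcomp
    classical
    apply key (insert a ((S \ {a}).filter (fun z => c z = i ∧ z ≤ x i)))
    · simp
    · intro u hu v hv
      rcases Finset.mem_insert.1 hu with rfl | hu <;> rcases Finset.mem_insert.1 hv with rfl | hv
      · exact Or.inl le_rfl
      · exact Or.inr ((Finset.mem_filter.1 hv).2.2.trans hia)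
      · exact Or.inl ((Finset.mem_filter.1 hu).2.2.trans hia)
      · obtain ⟨hu1, hu2, _⟩ := Finset.mem_filter.1 hu
        obtain ⟨hv1, hv2, _⟩ := Finset.mem_filter.1 hv
        exact hc2 u hu1 v hv1 (hu2.trans hv2.symm)
    · intro A hAs hAa
      by_contra hcon
      have hsub : A ⊆ S \ {a} := by
        intro z hz
        have := hAs hz
        simp only [Finset.mem_sdiff, Finset.mem_insert, not_or, Finset.mem_singleton] at this ⊢
        exact ⟨this.1, this.2.1⟩
      have hB : Big A := ⟨hsub, hAa, by omega⟩
      obtain ⟨y, hyA, hyi⟩ := hit A hB i hi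
      have hyx := (hx i hi).2.2.2 A hB y hyA hyi
      have := hAs hyA
      simp only [Finset.mem_sdiff, Finset.mem_insert, not_or] at this
      exact this.2.2 (Finset.mem_filter.2 ⟨hsub hyA, hyi, hyx⟩)

theorem dilworth_fin {X : Type*} [Fintype X] [DecidableEq X] [PartialOrder X] (d : ℕ)
    (h : ∀ A : Finset X, IsAntichain (· ≤ ·) (A : Set X) → A.card ≤ d) :
    ∃ c : X → Fin d, ∀ x y, c x = c y → x ≤ y ∨ y ≤ x := by
  obtain ⟨c, h1, h2⟩ := dilworth_aux _ (Finset.univ : Finset X) d le_rfl (fun A _ hA => h A hA)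
  refine ⟨fun x => ⟨c x, h1 x (Finset.mem_univ x)⟩, fun x y hxy => ?_⟩
  exact h2 x (Finset.mem_univ x) y (Finset.mem_univ y) (by simpa using hxy)

/-- The order of the lower bound construction. -/
def lbLe {X : Type*} (d : ℕ) (ch lv : X → ℕ) (x y : X) : Prop :=
  (ch x = ch y ∧ lv x ≤ lv y) ∨ lv x + d ≤ lv y

theorem redPair_up {X : Type*} [DecidableEq X] {le : X → X → Prop}
    (hanti : ∀ x y, le x y → le y x → x = y) {x x' z : X}
    (hz : z ≠ x) (h1 : le x z) (h2 : ¬ le x' z) : RedPair le {x, x'} {z} := by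
  refine ⟨fun h => h2 (h x' (by simp) z (by simp)), fun h => ?_, x, by simp, z, by simp, Or.inl h1⟩
  exact hz (hanti _ _ (h z (by simp) x (by simp)) h1)

theorem redPair_down {X : Type*} [DecidableEq X] {le : X → X → Prop}
    (hanti : ∀ x y, le x y → le y x → x = y) {x x' z : X}
    (hz : z ≠ x) (h1 : le z x) (h2 : ¬ le z x') : RedPair le {x, x'} {z} := by
  refine ⟨fun h => ?_, fun h => h2 (h z (by simp) x' (by simp)), x, by simp, z, by simp, Or.inr h1⟩
  exact hz (hanti _ _ h1 (h x (by simp) z (by simp)))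

/-- Any first contraction creates many red edges. -/
theorem lb_many_red {X : Type*} [DecidableEq X] (d : ℕ) (hd : 2 ≤ d) (ch lv : X → ℕ)
    (hch : ∀ x, ch x < d) (hlv : ∀ x, lv x < 2 * d)
    (hinj : ∀ x y, ch x = ch y → lv x = lv y → x = y)
    (g : ℕ → ℕ → X) (hg : ∀ i k, i < d → k < 2 * d → ch (g i k) = i ∧ lv (g i k) = k)
    (x x' : X) (hne : x ≠ x') :
    ∃ Z : Finset X, d - 1 ≤ Z.card ∧ ∀ z ∈ Z, z ≠ x ∧ z ≠ x' ∧
      RedPair (lbLe d ch lv) {x, x'} {z} := by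
  have hanti : ∀ x y, lbLe d ch lv x y → lbLe d ch lv y x → x = y := by
    intro x y h1 h2
    unfold lbLe at h1 h2
    apply hinj <;> omega
  have hup : ∀ x x' z : X, lv z ≠ lv x ∨ ch z ≠ ch x → lbLe d ch lv x z → ¬ lbLe d ch lv x' z →
      z ≠ x ∧ z ≠ x' ∧ RedPair (lbLe d ch lv) {x, x'} {z} := by
    intro x x' z hz h1 h2
    have hzx : z ≠ x := by rintro rfl; simp at hz
    refine ⟨hzx, ?_, redPair_up hanti hzx h1 h2⟩
    rintro rfl; exact h2 (Or.inl ⟨rfl, le_rfl⟩)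
  have hdown : ∀ x x' z : X, lv z ≠ lv x ∨ ch z ≠ ch x → lbLe d ch lv z x → ¬ lbLe d ch lv z x' →
      z ≠ x ∧ z ≠ x' ∧ RedPair (lbLe d ch lv) {x, x'} {z} := by
    intro x x' z hz h1 h2
    have hzx : z ≠ x := by rintro rfl; simp at hz
    refine ⟨hzx, ?_, redPair_down hanti hzx h1 h2⟩
    rintro rfl; exact h2 (Or.inl ⟨rfl, le_rfl⟩)
  have hx := hch x
  have hx' := hch x'
  have hlx := hlv x
  have hlx' := hlv x'
  wlog hle : lv x' ≤ lv x generalizing x x'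
  · obtain ⟨Z, hZ, h⟩ := this x' x hne.symm hx' hx hlx' hlx (by omega)
    refine ⟨Z, hZ, fun z hz => ?_⟩
    obtain ⟨h1, h2, h3⟩ := h z hz
    rw [Finset.pair_comm] at h3
    exact ⟨h2, h1, h3⟩
  by_cases hc : ch x = ch x'
  · have hlt : lv x' < lv x := by
      rcases Nat.lt_or_ge (lv x') (lv x) with h | h
      · exact h
      · exact absurd (hinj _ _ hc (by omega)) hne
    have hcard : ∀ k, k < 2 * d →
        (((Finset.range d).erase (ch x)).image (fun i => g i k)).card = d - 1 := by
      intro k hk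
      rw [Finset.card_image_of_injOn, Finset.card_erase_of_mem (by simpa using hx),
        Finset.card_range]
      intro i hi j hj hij
      simp only [Finset.coe_erase, Finset.coe_range, Set.mem_sdiff, Set.mem_Iio] at hi hj
      have h1 := (hg i k hi.1 hk).1
      have h2 := (hg j k hj.1 hk).1
      simp only at hij
      rw [← h1, ← h2, hij]
    by_cases hk : lv x' + d < 2 * d
    · refine ⟨_, (hcard _ hk).ge, ?_⟩
      intro z hz
      obtain ⟨i, hi, rfl⟩ := Finset.mem_image.1 hz
      simp only [Finset.mem_erase, Finset.mem_range] at hi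
      obtain ⟨h1, h2⟩ := hg i _ hi.2 hk
      have := hup x' x (g i (lv x' + d)) (by omega) (by unfold lbLe; omega)
        (by unfold lbLe; omega)
      rw [Finset.pair_comm] at this
      exact ⟨this.2.1, this.1, this.2.2⟩
    · have hk2 : lv x - d < 2 * d := by omega
      refine ⟨_, (hcard _ hk2).ge, ?_⟩
      intro z hz
      obtain ⟨i, hi, rfl⟩ := Finset.mem_image.1 hz
      simp only [Finset.mem_erase, Finset.mem_range] at hi
      obtain ⟨h1, h2⟩ := hg i _ hi.2 hk2
      exact hdown x x' (g i (lv x - d)) (by omega) (by unfold lbLe; omega)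
        (by unfold lbLe; omega)
  · have hcard : ∀ i s, i < d → s + d ≤ 2 * d + 1 →
        ((Finset.range (d - 1)).image (fun k => g i (s + k))).card = d - 1 := by
      intro i s hi hs
      rw [Finset.card_image_of_injOn, Finset.card_range]
      intro k hk l hl hkl
      simp only [Finset.coe_range, Set.mem_Iio] at hk hl
      have h1 := (hg i (s + k) hi (by omega)).2
      have h2 := (hg i (s + l) hi (by omega)).2
      simp only at hkl
      rw [hkl] at h1
      omega
    by_cases hk : lv x ≤ d
    · refine ⟨_, (hcard (ch x') (lv x + 1) hx' (by omega)).ge, ?_⟩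
      intro z hz
      obtain ⟨k, hk', rfl⟩ := Finset.mem_image.1 hz
      simp only [Finset.mem_range] at hk'
      obtain ⟨h1, h2⟩ := hg (ch x') (lv x + 1 + k) hx' (by omega)
      have := hup x' x (g (ch x') (lv x + 1 + k)) (by omega) (by unfold lbLe; omega)
        (by unfold lbLe; omega)
      rw [Finset.pair_comm] at this
      exact ⟨this.2.1, this.1, this.2.2⟩
    · refine ⟨_, (hcard (ch x) (lv x + 1 - d) hx (by omega)).ge, ?_⟩
      intro z hz
      obtain ⟨k, hk', rfl⟩ := Finset.mem_image.1 hz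
      simp only [Finset.mem_range] at hk'
      obtain ⟨h1, h2⟩ := hg (ch x) (lv x + 1 - d + k) hx (by omega)
      exact hdown x x' (g (ch x) (lv x + 1 - d + k)) (by omega) (by unfold lbLe; omega)
        (by unfold lbLe; omega)

/-- If every first contraction creates red degree at least `e + 1`, the twin-width exceeds `e`. -/
theorem not_tww_of_first {X : Type*} [Fintype X] [DecidableEq X] (le : X → X → Prop) (e : ℕ)
    (hcard : 2 ≤ Fintype.card X)
    (h : ∀ x x' : X, x ≠ x' → ∃ Z : Finset X, e < Z.card ∧ ∀ z ∈ Z, z ≠ x ∧ z ≠ x' ∧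
      RedPair le {x, x'} {z}) : ¬ NatTwinWidthLE le e := by
  rintro ⟨n, seq, -, h0, hlast, hstep, hred⟩
  rcases n with _ | n
  · have hh : (Finset.univ.image (fun x => ({x} : Finset X))).card = 1 := by
      rw [← h0, show (0 : Fin (0 + 1)) = Fin.last 0 from rfl, hlast]; simp
    rw [Finset.card_image_of_injective _ Finset.singleton_injective, Finset.card_univ] at hh
    omega
  · obtain ⟨B, hB, C, hC, hBC, hQ⟩ := hstep 0
    rw [Fin.castSucc_zero, h0] at hB hC hQ
    obtain ⟨x, -, rfl⟩ := Finset.mem_image.1 hB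
    obtain ⟨x', -, rfl⟩ := Finset.mem_image.1 hC
    have hne : x ≠ x' := by rintro rfl; exact hBC rfl
    obtain ⟨Z, hZ, hz⟩ := h x x' hne
    have hU : ({x} ∪ {x'} : Finset X) = {x, x'} := rfl
    rw [hU] at hQ
    have hr := hred (Fin.succ 0) {x, x'} (by rw [hQ]; simp)
    apply absurd hr
    rw [not_le]
    refine lt_of_lt_of_le hZ ?_
    rw [← Finset.card_image_of_injective Z Finset.singleton_injective]
    unfold redDeg
    apply Finset.card_le_card
    intro S hS
    obtain ⟨z, hzZ, rfl⟩ := Finset.mem_image.1 hS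
    obtain ⟨h1, h2, h3⟩ := hz z hzZ
    simp only [Finset.mem_filter]
    refine ⟨?_, ?_, h3⟩
    · rw [hQ]; simp [h1, h2]
    · intro hzz
      have : x ∈ ({z} : Finset X) := by rw [hzz]; simp
      simp at this
      exact h1 this.symm

theorem lower_bound (d : ℕ) (hd : 2 ≤ d) :
    ∃ (n : ℕ) (le : Fin n → Fin n → Prop),
      IsPartialOrder (Fin n) le ∧
      (∀ A : Finset (Fin n),
        (∀ x ∈ A, ∀ y ∈ A, x ≠ y → ¬ le x y ∧ ¬ le y x) → A.card ≤ d) ∧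
      (∃ A : Finset (Fin n),
        (∀ x ∈ A, ∀ y ∈ A, x ≠ y → ¬ le x y ∧ ¬ le y x) ∧ A.card = d) ∧
      ¬ NatTwinWidthLE le (d - 2) := by
  let e : Fin d × Fin (2 * d) ≃ Fin (d * (2 * d)) := finProdFinEquiv
  let ch : Fin (d * (2 * d)) → ℕ := fun x => (e.symm x).1
  let lv : Fin (d * (2 * d)) → ℕ := fun x => (e.symm x).2
  let g : ℕ → ℕ → Fin (d * (2 * d)) := fun i k =>
    if h : i < d ∧ k < 2 * d then e (⟨i, h.1⟩, ⟨k, h.2⟩)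
    else e (⟨0, by omega⟩, ⟨0, by omega⟩)
  have hch : ∀ x, ch x < d := fun x => (e.symm x).1.2
  have hlv : ∀ x, lv x < 2 * d := fun x => (e.symm x).2.2
  have hinj : ∀ x y, ch x = ch y → lv x = lv y → x = y := by
    intro x y h1 h2
    apply e.symm.injective
    exact Prod.ext (Fin.ext h1) (Fin.ext h2)
  have hg : ∀ i k, i < d → k < 2 * d → ch (g i k) = i ∧ lv (g i k) = k := by
    intro i k hi hk
    simp [ch, lv, g, hi, hk]
  clear_value ch lv g
  refine ⟨d * (2 * d), lbLe d ch lv, ?_, ?_, ?_, ?_⟩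
  · refine { refl := ?_, trans := ?_, antisymm := ?_ }
    · intro x; exact Or.inl ⟨rfl, le_rfl⟩
    · intro x y z h1 h2; unfold lbLe at *; omega
    · intro x y h1 h2; unfold lbLe at *; apply hinj <;> omega
  · intro A hA
    have := Finset.card_le_card_of_injOn (s := A) (t := Finset.range d) ch
      (fun x _ => by simpa using hch x) (by
        intro x hx y hy hxy
        by_contra hne
        have := hA x hx y hy hne
        unfold lbLe at this; omega)
    simpa using this
  · refine ⟨(Finset.range d).image (fun i => g i 0), ?_, ?_⟩
    · intro x hx y hy hne
      obtain ⟨i, hi, rfl⟩ := Finset.mem_image.1 hx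
      obtain ⟨j, hj, rfl⟩ := Finset.mem_image.1 hy
      have h1 := hg i 0 (by simpa using hi) (by omega)
      have h2 := hg j 0 (by simpa using hj) (by omega)
      have : i ≠ j := by rintro rfl; exact hne rfl
      unfold lbLe; omega
    · rw [Finset.card_image_of_injOn, Finset.card_range]
      intro i hi j hj hij
      have h1 := hg i 0 (by simpa using hi) (by omega)
      have h2 := hg j 0 (by simpa using hj) (by omega)
      simp only at hij
      rw [← h1.1, ← h2.1, hij]
  · apply not_tww_of_first
    · simp; nlinarith
    · intro x x' hne
      obtain ⟨Z, h1, h2⟩ := lb_many_red d hd ch lv hch hlv hinj g hg x x' hne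
      exact ⟨Z, by omega, h2⟩

/-- Partitions from which a contraction sequence of red degree at most `D` exists. -/
inductive CSeq {X : Type*} [Fintype X] [DecidableEq X] (le : X → X → Prop) (D : ℕ) :
    Finset (Finset X) → Prop
  | done (P : Finset (Finset X)) : P = {Finset.univ} → IsPartitionOf P →
      (∀ B ∈ P, redDeg le P B ≤ D) → CSeq le D P
  | step (P Q : Finset (Finset X)) : IsPartitionOf P → (∀ B ∈ P, redDeg le P B ≤ D) →
      MergeStep P Q → CSeq le D Q → CSeq le D P

theorem CSeq.exists_seq {X : Type*} [Fintype X] [DecidableEq X] {le : X → X → Prop} {D : ℕ}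
    {P : Finset (Finset X)} (h : CSeq le D P) :
    ∃ (n : ℕ) (seq : Fin (n + 1) → Finset (Finset X)),
    (∀ i, IsPartitionOf (seq i)) ∧
    seq 0 = P ∧
    seq (Fin.last n) = {Finset.univ} ∧
    (∀ i : Fin n, MergeStep (seq i.castSucc) (seq i.succ)) ∧
    ∀ i, ∀ B ∈ seq i, redDeg le (seq i) B ≤ D := by
  induction h with
  | done P h1 h2 h3 =>
    exact ⟨0, fun _ => P, fun _ => h2, rfl, h1, fun i => i.elim0, fun _ => h3⟩
  | step P Q h1 h2 h3 _ ih =>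
    obtain ⟨n, seq, g1, g2, g3, g4, g5⟩ := ih
    refine ⟨n + 1, Fin.cons P seq, ?_, rfl, ?_, ?_, ?_⟩
    · intro i
      refine Fin.cases ?_ (fun j => ?_) i
      · simpa using h1
      · simpa using g1 j
    · rw [← Fin.succ_last, Fin.cons_succ]; exact g3
    · intro i
      refine Fin.cases ?_ (fun j => ?_) i
      · simpa [g2] using h3
      · rw [Fin.castSucc_succ, Fin.cons_succ, Fin.cons_succ]; exact g4 j
    · intro i
      refine Fin.cases ?_ (fun j => ?_) i
      · simpa using h2
      · simpa using g5 j

theorem mem_partition_eq {X : Type*} {P : Finset (Finset X)} (hP : IsPartitionOf P)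
    {B C : Finset X} (hB : B ∈ P) (hC : C ∈ P) {x : X} (h1 : x ∈ B) (h2 : x ∈ C) : B = C :=
  (hP.2 x).unique ⟨hB, h1⟩ ⟨hC, h2⟩

theorem MergeStep.partition {X : Type*} [DecidableEq X] {P Q : Finset (Finset X)}
    (h : MergeStep P Q) (hP : IsPartitionOf P) : IsPartitionOf Q := by
  obtain ⟨B, hB, C, hC, hBC, rfl⟩ := h
  refine ⟨?_, ?_⟩
  · intro S hS
    rcases Finset.mem_insert.1 hS with rfl | hS
    · exact (hP.1 B hB).mono Finset.subset_union_left
    · exact hP.1 S (Finset.mem_of_mem_erase (Finset.mem_of_mem_erase hS))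
  · intro x
    obtain ⟨S, ⟨hS, hxS⟩, _⟩ := hP.2 x
    by_cases hSBC : S = B ∨ S = C
    · refine ⟨B ∪ C, ⟨by simp, ?_⟩, ?_⟩
      · rcases hSBC with rfl | rfl <;> simp [hxS]
      · rintro R ⟨hR, hxR⟩
        rcases Finset.mem_insert.1 hR with rfl | hR
        · rfl
        · simp only [Finset.mem_erase] at hR
          have := mem_partition_eq hP hR.2.2 hS hxR hxS
          subst this
          rcases hSBC with h | h
          · exact absurd h hR.2.1
          · exact absurd h hR.1
    · push Not at hSBC
      refine ⟨S, ⟨by simp [hSBC, hS], hxS⟩, ?_⟩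
      rintro R ⟨hR, hxR⟩
      rcases Finset.mem_insert.1 hR with rfl | hR
      · rcases Finset.mem_union.1 hxR with h | h
        · exact absurd (mem_partition_eq hP hS hB hxS h) hSBC.1
        · exact absurd (mem_partition_eq hP hS hC hxS h) hSBC.2
      · simp only [Finset.mem_erase] at hR
        exact mem_partition_eq hP hR.2.2 hS hxR hxS

theorem redDeg_lt_card {X : Type*} (le : X → X → Prop) {P : Finset (Finset X)} {B : Finset X}
    (hB : B ∈ P) : redDeg le P B < P.card := by
  unfold redDeg
  apply Finset.card_lt_card
  refine ⟨fun C hC => ?_, fun h => ?_⟩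
  · simp only [Finset.mem_filter] at hC
    exact hC.1
  · have := h hB
    simp at this

theorem CSeq.of_small {X : Type*} [Fintype X] [DecidableEq X] [Nonempty X] (le : X → X → Prop)
    (D : ℕ) (m : ℕ) : ∀ P : Finset (Finset X), IsPartitionOf P → P.card ≤ D + 1 → P.card = m →
    CSeq le D P := by
  induction m using Nat.strong_induction_on with
  | _ m ih =>
    intro P hP hc hm
    have hred : ∀ B ∈ P, redDeg le P B ≤ D := by
      intro B hB
      have := redDeg_lt_card le hB
      omega
    by_cases h1 : P.card ≤ 1
    · refine CSeq.done P ?_ hP hred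
      obtain ⟨x⟩ := ‹Nonempty X›
      obtain ⟨B, ⟨hB, _⟩, _⟩ := hP.2 x
      have hall : ∀ C ∈ P, C = B := fun C hC => Finset.card_le_one.1 h1 C hC B hB
      have hPB : P = {B} := Finset.eq_singleton_iff_unique_mem.2 ⟨hB, hall⟩
      have : B = Finset.univ := by
        ext y
        obtain ⟨C, ⟨hC, hy⟩, _⟩ := hP.2 y
        rw [hall C hC] at hy
        simp [hy]
      rw [hPB, this]
    · obtain ⟨B, hB, C, hC, hBC⟩ := Finset.one_lt_card.1 (not_le.1 h1)
      have hM : MergeStep P (insert (B ∪ C) ((P.erase B).erase C)) := ⟨B, hB, C, hC, hBC, rfl⟩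
      have hcard : (insert (B ∪ C) ((P.erase B).erase C)).card < P.card := by
        refine lt_of_le_of_lt (Finset.card_insert_le _ _) ?_
        rw [Finset.card_erase_of_mem (by simp [hC, hBC.symm]), Finset.card_erase_of_mem hB]
        omega
      exact CSeq.step P _ hP hred hM (ih _ (hm ▸ hcard) _ (hM.partition hP) (by omega) rfl)

section counting

open Classical in
theorem card_split {X : Type*} {d : ℕ} (c : X → Fin d) (T : Finset X) (i : Fin d)
    (Q : X → Prop) : (T.filter (fun s => c s ≠ i ∧ Q s)).card =
      ∑ j ∈ Finset.univ.erase i, (T.filter (fun s => c s = j ∧ Q s)).card := by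
  rw [Finset.card_eq_sum_card_fiberwise (f := c) (t := Finset.univ.erase i)]
  · apply Finset.sum_congr rfl
    intro j hj
    congr 1
    ext s
    simp only [Finset.mem_filter]
    constructor
    · rintro ⟨⟨h1, h2, h3⟩, h4⟩; exact ⟨h1, h4, h3⟩
    · rintro ⟨h1, h2, h3⟩
      exact ⟨⟨h1, by rw [h2]; exact Finset.ne_of_mem_erase hj, h3⟩, h2⟩
  · intro s hs
    have := (Finset.mem_filter.1 hs).2.1
    simp [this]

open Classical in
theorem card_le_two_add {X : Type*} [PartialOrder X] (F G : Finset X)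
    (hF : ∀ x ∈ F, ∀ y ∈ F, x ≤ y ∨ y ≤ x)
    (h : ∀ s ∈ F, ∀ s' ∈ F, ∀ s'' ∈ F, s' < s → s < s'' → s ∈ G) : F.card ≤ 2 + G.card := by
  rcases F.eq_empty_or_nonempty with rfl | hne
  · simp
  obtain ⟨a, ha, hamax⟩ := F.exists_maximal hne
  obtain ⟨b, hb, hbmin⟩ := F.exists_minimal hne
  have hsub : F ⊆ insert a (insert b G) := by
    intro s hs
    by_cases hsa : s = a
    · simp [hsa]
    by_cases hsb : s = b
    · simp [hsb]
    have h1 : s ≤ a := (hF s hs a ha).elim id (fun h => hamax hs h)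
    have h2 : b ≤ s := (hF b hb s hs).elim id (fun h => hbmin hs h)
    have := h s hs b hb a ha (lt_of_le_of_ne h2 (Ne.symm hsb)) (lt_of_le_of_ne h1 hsa)
    simp [this]
  calc F.card ≤ _ := Finset.card_le_card hsub
    _ ≤ _ := Finset.card_insert_le _ _
    _ ≤ _ := Nat.succ_le_succ (Finset.card_insert_le _ _)
    _ = 2 + G.card := by omega

open Classical in
theorem card_unique_le {X : Type*} {d : ℕ} (c : X → Fin d) (T : Finset X) (i : Fin d)
    (Q : X → Prop) (h : ∀ t ∈ T, ∀ t' ∈ T, c t = c t' → Q t → Q t' → t = t') :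
    (T.filter (fun s => c s ≠ i ∧ Q s)).card ≤ d - 1 := by
  rw [card_split]
  calc _ ≤ ∑ j ∈ Finset.univ.erase i, 1 := by
        apply Finset.sum_le_sum
        intro j _
        rw [Finset.card_le_one]
        intro a ha b hb
        simp only [Finset.mem_filter] at ha hb
        exact h a ha.1 b hb.1 (ha.2.1.trans hb.2.1.symm) ha.2.2 hb.2.2
    _ = d - 1 := by simp

open Classical in
theorem double_count {X : Type*} [PartialOrder X] {d : ℕ} (c : X → Fin d)
    (hc : ∀ x y, c x = c y → x ≤ y ∨ y ≤ x) (T : Finset X) (R Q : X → X → Prop)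
    (h1 : ∀ t ∈ T, ∀ s ∈ T, ∀ s' ∈ T, ∀ s'' ∈ T, c s' = c s → c s'' = c s → s' < s → s < s'' →
      R s' t → R s'' t → Q s t)
    (h2 : ∀ s ∈ T, ∀ t ∈ T, ∀ t' ∈ T, c t = c t' → Q s t → Q s t' → t = t') :
    ∑ s ∈ T, (T.filter (fun t => c t ≠ c s ∧ R s t)).card ≤ 3 * (d - 1) * T.card := by
  have hswap : ∀ R : X → X → Prop, ∑ s ∈ T, (T.filter (fun t => c t ≠ c s ∧ R s t)).card =
      ∑ t ∈ T, (T.filter (fun s => c s ≠ c t ∧ R s t)).card := by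
    intro R
    simp only [Finset.card_filter]
    rw [Finset.sum_comm]
    simp only [ne_comm]
  rw [hswap]
  have hb : ∀ t ∈ T, (T.filter (fun s => c s ≠ c t ∧ R s t)).card ≤
      2 * (d - 1) + (T.filter (fun s => c s ≠ c t ∧ Q s t)).card := by
    intro t ht
    rw [card_split, card_split]
    calc _ ≤ ∑ j ∈ Finset.univ.erase (c t), (2 + (T.filter (fun s => c s = j ∧ Q s t)).card) := by
          apply Finset.sum_le_sum
          intro j _
          apply card_le_two_add
          · intro x hx y hy
            simp only [Finset.mem_filter] at hx hy
            exact hc x y (hx.2.1.trans hy.2.1.symm)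
          · intro s hs s' hs' s'' hs'' hlt hlt'
            simp only [Finset.mem_filter] at hs hs' hs'' ⊢
            exact ⟨hs.1, hs.2.1, h1 t ht s hs.1 s' hs'.1 s'' hs''.1 (hs'.2.1.trans hs.2.1.symm)
              (hs''.2.1.trans hs.2.1.symm) hlt hlt' hs'.2.2 hs''.2.2⟩
      _ = _ := by
          rw [Finset.sum_add_distrib]
          simp [mul_comm]
  calc _ ≤ ∑ t ∈ T, (2 * (d - 1) + (T.filter (fun s => c s ≠ c t ∧ Q s t)).card) :=
        Finset.sum_le_sum hb
    _ = 2 * (d - 1) * T.card + ∑ s ∈ T, (T.filter (fun t => c t ≠ c s ∧ Q s t)).card := by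
        rw [Finset.sum_add_distrib, hswap Q]
        simp [mul_comm]
    _ ≤ 2 * (d - 1) * T.card + ∑ s ∈ T, (d - 1) := by
        gcongr with s hs
        exact card_unique_le c T (c s) (Q s) (h2 s hs)
    _ = 3 * (d - 1) * T.card := by
        simp; ring

end counting

section blocks

set_option linter.unusedSectionVars false

variable {X : Type*} [Fintype X] [DecidableEq X] [PartialOrder X] {d : ℕ}

open Classical in
/-- The block of `x` when the chains (colour classes of `c`) are cut below the elements of `T`. -/
noncomputable def blk (c : X → Fin d) (T : Finset X) (x : X) : Finset X :=
  Finset.univ.filter (fun y => c y = c x ∧ ∀ t ∈ T, c t = c x → (t ≤ x ↔ t ≤ y))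

theorem mem_blk {c : X → Fin d} {T : Finset X} {x y : X} :
    y ∈ blk c T x ↔ c y = c x ∧ ∀ t ∈ T, c t = c x → (t ≤ x ↔ t ≤ y) := by
  simp [blk]

theorem self_mem_blk (c : X → Fin d) (T : Finset X) (x : X) : x ∈ blk c T x := by
  simp [mem_blk]

theorem blk_eq {c : X → Fin d} {T : Finset X} {x y : X} (h : y ∈ blk c T x) :
    blk c T y = blk c T x := by
  obtain ⟨h1, h2⟩ := mem_blk.1 h
  ext z
  rw [mem_blk, mem_blk, h1]
  constructor
  · rintro ⟨h3, h4⟩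
    exact ⟨h3, fun t ht hct => (h2 t ht hct).trans (h4 t ht hct)⟩
  · rintro ⟨h3, h4⟩
    exact ⟨h3, fun t ht hct => (h2 t ht hct).symm.trans (h4 t ht hct)⟩

/-- The partition into blocks. -/
noncomputable def parts (c : X → Fin d) (T : Finset X) : Finset (Finset X) :=
  Finset.univ.image (blk c T)

theorem parts_partition (c : X → Fin d) (T : Finset X) : IsPartitionOf (parts c T) := by
  refine ⟨?_, ?_⟩
  · intro B hB
    obtain ⟨x, -, rfl⟩ := Finset.mem_image.1 hB
    exact ⟨x, self_mem_blk c T x⟩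
  · intro x
    refine ⟨blk c T x, ⟨Finset.mem_image_of_mem _ (Finset.mem_univ x), self_mem_blk c T x⟩, ?_⟩
    rintro B ⟨hB, hx⟩
    obtain ⟨y, -, rfl⟩ := Finset.mem_image.1 hB
    exact (blk_eq hx).symm

/-- Cut `t` is touched by the relation of being below `J`. -/
def CutA (p : X → X) (J : Finset X) (t : X) : Prop :=
  (∃ y ∈ J, ¬ t ≤ y) ∧ ∃ y ∈ J, p t ≤ y

/-- Cut `t` is touched by the relation of being above `J`. -/
def CutB (p : X → X) (J : Finset X) (t : X) : Prop :=
  (∃ y ∈ J, y ≤ t) ∧ ∃ y ∈ J, ¬ y ≤ p t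

open Classical in
/-- The number of cuts touched by `J` outside colour `i`. -/
noncomputable def touch (c : X → Fin d) (p : X → X) (T : Finset X) (i : Fin d) (J : Finset X) : ℕ :=
  (T.filter (fun t => c t ≠ i ∧ CutA p J t)).card + (T.filter (fun t => c t ≠ i ∧ CutB p J t)).card

/-- `p` is the predecessor function within colour classes, on `T`. -/
def IsPred (c : X → Fin d) (p : X → X) (T : Finset X) : Prop :=
  ∀ t ∈ T, p t < t ∧ c (p t) = c t ∧ ∀ x, c x = c t → x < t → x ≤ p t

theorem touch_mono {c : X → Fin d} {p : X → X} {T T' : Finset X} (h : T' ⊆ T) (i : Fin d)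
    (J : Finset X) : touch c p T' i J ≤ touch c p T i J := by
  unfold touch
  gcongr

theorem lt_of_not_le {c : X → Fin d} (hc : ∀ x y, c x = c y → x ≤ y ∨ y ≤ x) {x y : X}
    (h : c x = c y) (hn : ¬ x ≤ y) : y < x :=
  lt_of_le_not_ge ((hc x y h).resolve_left hn) hn

theorem uniqA {c : X → Fin d} (hc : ∀ x y, c x = c y → x ≤ y ∨ y ≤ x) {p : X → X} {T : Finset X}
    (hp : IsPred c p T) (s : X) : ∀ t ∈ T, ∀ t' ∈ T, c t = c t' →
      (p t ≤ s ∧ ¬ t ≤ s) → (p t' ≤ s ∧ ¬ t' ≤ s) → t = t' := by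
  intro t ht t' ht' hcc h h'
  by_contra hne
  rcases hc t t' hcc with hle | hle
  · exact h.2 (((hp t' ht').2.2 t hcc (lt_of_le_of_ne hle hne)).trans h'.1)
  · exact h'.2 (((hp t ht).2.2 t' hcc.symm (lt_of_le_of_ne hle (Ne.symm hne))).trans h.1)

theorem uniqB {c : X → Fin d} (hc : ∀ x y, c x = c y → x ≤ y ∨ y ≤ x) {p : X → X} {T : Finset X}
    (hp : IsPred c p T) (s : X) : ∀ t ∈ T, ∀ t' ∈ T, c t = c t' →
      (s ≤ t ∧ ¬ s ≤ p t) → (s ≤ t' ∧ ¬ s ≤ p t') → t = t' := by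
  intro t ht t' ht' hcc h h'
  by_contra hne
  rcases hc t t' hcc with hle | hle
  · exact h'.2 (h.1.trans ((hp t' ht').2.2 t hcc (lt_of_le_of_ne hle hne)))
  · exact h.2 (h'.1.trans ((hp t ht).2.2 t' hcc.symm (lt_of_le_of_ne hle (Ne.symm hne))))

theorem touch_singleton {c : X → Fin d} (hc : ∀ x y, c x = c y → x ≤ y ∨ y ≤ x) {p : X → X}
    {T : Finset X} (hp : IsPred c p T) (i : Fin d) (x : X) :
    touch c p T i {x} ≤ 2 * (d - 1) := by
  unfold touch
  have hA := card_unique_le c T i (CutA p {x}) (fun t ht t' ht' hcc h h' =>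
    uniqA hc hp x t ht t' ht' hcc ⟨by simpa using h.2, by simpa using h.1⟩
      ⟨by simpa using h'.2, by simpa using h'.1⟩)
  have hB := card_unique_le c T i (CutB p {x}) (fun t ht t' ht' hcc h h' =>
    uniqB hc hp x t ht t' ht' hcc ⟨by simpa using h.1, by simpa using h.2⟩
      ⟨by simpa using h'.1, by simpa using h'.2⟩)
  omega

theorem lt_of_mem_merged {c : X → Fin d} (hc : ∀ x y, c x = c y → x ≤ y ∨ y ≤ x)
    {T : Finset X} {s s' y : X} (hs : s ∈ T) (hcs : c s' = c s)
    (hlt : s' < s) (hy : y ∈ blk c (T.erase s') s') : y < s := by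
  obtain ⟨h1, h2⟩ := mem_blk.1 hy
  have := h2 s (Finset.mem_erase.2 ⟨hlt.ne', hs⟩) hcs.symm
  apply lt_of_not_le hc (hcs.symm.trans h1.symm)
  rw [← this]
  exact not_le_of_gt hlt

theorem le_of_mem_merged {c : X → Fin d}
    {T : Finset X} {s s' y : X} (hs : s ∈ T) (hcs : c s' = c s)
    (hlt : s < s') (hy : y ∈ blk c (T.erase s') s') : s ≤ y := by
  obtain ⟨h1, h2⟩ := mem_blk.1 hy
  exact (h2 s (Finset.mem_erase.2 ⟨hlt.ne, hs⟩) hcs.symm).1 hlt.le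

theorem sum_touch {c : X → Fin d} (hc : ∀ x y, c x = c y → x ≤ y ∨ y ≤ x) {p : X → X}
    {T : Finset X} (hp : IsPred c p T) :
    ∑ s ∈ T, touch c p T (c s) (blk c (T.erase s) s) ≤ 6 * (d - 1) * T.card := by
  unfold touch
  rw [Finset.sum_add_distrib]
  have hA := double_count c hc T (fun s t => CutA p (blk c (T.erase s) s) t)
    (fun s t => p t ≤ s ∧ ¬ t ≤ s) (by
      intro t ht s hs s' hs' s'' hs'' hcs' hcs'' hlt hlt' hR' hR''
      obtain ⟨y', hy', h'⟩ := hR'.2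
      obtain ⟨y'', hy'', h''⟩ := hR''.1
      exact ⟨h'.trans (lt_of_mem_merged hc hs hcs' hlt hy').le,
        fun h => h'' (h.trans (le_of_mem_merged hs hcs'' hlt' hy''))⟩)
    (fun s _ => uniqA hc hp s)
  have hB := double_count c hc T (fun s t => CutB p (blk c (T.erase s) s) t)
    (fun s t => s ≤ t ∧ ¬ s ≤ p t) (by
      intro t ht s hs s' hs' s'' hs'' hcs' hcs'' hlt hlt' hR' hR''
      obtain ⟨y', hy', h'⟩ := hR'.2
      obtain ⟨y'', hy'', h''⟩ := hR''.1
      exact ⟨(le_of_mem_merged hs hcs'' hlt' hy'').trans h'',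
        fun h => h' ((lt_of_mem_merged hc hs hcs' hlt hy').le.trans h)⟩)
    (fun s _ => uniqB hc hp s)
  calc _ ≤ 3 * (d - 1) * T.card + 3 * (d - 1) * T.card := Nat.add_le_add hA hB
    _ = _ := by ring

/-- Distinct blocks of one chain are separated by a cut that lies in the upper one. -/
theorem exists_start {c : X → Fin d} (hc : ∀ x y, c x = c y → x ≤ y ∨ y ≤ x)
    {T : Finset X} {z z₀ : X} (hcz : c z₀ = c z) (hle : z₀ ≤ z) (hne : blk c T z ≠ blk c T z₀) :
    ∃ t ∈ T, c t = c z ∧ blk c T t = blk c T z ∧ (∀ w ∈ blk c T z, t ≤ w) ∧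
      ∀ w ∈ blk c T z₀, w < t := by
  classical
  let F := T.filter (fun t => c t = c z ∧ t ≤ z ∧ ¬ t ≤ z₀)
  have hF : F.Nonempty := by
    by_contra hcon
    apply hne
    apply (blk_eq _).symm
    rw [mem_blk]
    refine ⟨hcz, fun t ht hct => ⟨fun h => ?_, fun h => h.trans hle⟩⟩
    by_contra hn
    exact hcon ⟨t, Finset.mem_filter.2 ⟨ht, hct, h, hn⟩⟩
  obtain ⟨t, htF, htm⟩ := F.exists_maximal hF
  obtain ⟨htT, hct, htz, htz₀⟩ := Finset.mem_filter.1 htF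
  refine ⟨t, htT, hct, blk_eq ?_, ?_, ?_⟩
  · rw [mem_blk]
    refine ⟨hct, fun u hu hcu => ⟨fun h => ?_, fun h => h.trans htz⟩⟩
    rcases hc u t (hcu.trans hct.symm) with h' | h'
    · exact h'
    · exact htm (Finset.mem_filter.2 ⟨hu, hcu, h, fun h'' => htz₀ (h'.trans h'')⟩) h'
  · intro w hw
    exact ((mem_blk.1 hw).2 t htT hct).1 htz
  · intro w hw
    obtain ⟨h1, h2⟩ := mem_blk.1 hw
    apply lt_of_not_le hc (hct.trans (hcz.symm.trans h1.symm))
    rw [← h2 t htT (hct.trans hcz.symm)]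
    exact htz₀

open Classical in
/-- Counting blocks of one colour through touched cuts. -/
theorem card_blocks_le {c : X → Fin d} (hc : ∀ x y, c x = c y → x ≤ y ∨ y ≤ x)
    (T : Finset X) (i : Fin d) (M : Finset X → Prop) (R : X → Prop)
    (h : ∀ C₀ C : Finset X, M C₀ → M C → ∀ t ∈ T, (∀ w ∈ C, t ≤ w) → (∀ w ∈ C₀, w < t) → R t) :
    (((Finset.univ.filter (fun z => c z = i ∧ M (blk c T z))).image (blk c T))).card ≤
      1 + (T.filter (fun t => c t = i ∧ R t)).card := by
  let G := Finset.univ.filter (fun z => c z = i ∧ M (blk c T z))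
  change (G.image (blk c T)).card ≤ _
  rcases G.eq_empty_or_nonempty with hG | hG
  · rw [hG]; simp
  obtain ⟨z₀, hz₀, hmin⟩ := G.exists_minimal hG
  obtain ⟨-, hz₀i, hz₀M⟩ := Finset.mem_filter.1 hz₀
  have hsub : G.image (blk c T) ⊆
      insert (blk c T z₀) ((T.filter (fun t => c t = i ∧ R t)).image (blk c T)) := by
    intro C hC
    obtain ⟨z, hz, rfl⟩ := Finset.mem_image.1 hC
    by_cases hne : blk c T z = blk c T z₀
    · simp [hne]
    obtain ⟨-, hzi, hzM⟩ := Finset.mem_filter.1 hz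
    have hle : z₀ ≤ z := (hc z₀ z (hz₀i.trans hzi.symm)).elim id (fun h => hmin hz h)
    obtain ⟨t, htT, hct, hblk, h1, h2⟩ := exists_start hc (hz₀i.trans hzi.symm) hle hne
    refine Finset.mem_insert_of_mem (Finset.mem_image.2 ⟨t, Finset.mem_filter.2
      ⟨htT, hct.trans hzi, h _ _ hz₀M hzM t htT h1 h2⟩, hblk⟩)
  calc _ ≤ _ := Finset.card_le_card hsub
    _ ≤ _ := Finset.card_insert_le _ _
    _ ≤ (T.filter (fun t => c t = i ∧ R t)).card + 1 := Nat.succ_le_succ Finset.card_image_le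
    _ = _ := by omega

open Classical in
theorem redDeg_le {c : X → Fin d} (hc : ∀ x y, c x = c y → x ≤ y ∨ y ≤ x) {p : X → X}
    {T : Finset X} (hp : IsPred c p T) (x : X) :
    redDeg (· ≤ ·) (parts c T) (blk c T x) ≤ 2 * (d - 1) + touch c p T (c x) (blk c T x) := by
  let J := blk c T x
  obtain ⟨MA, hMA⟩ : ∃ M : Finset X → Prop, ∀ C, M C ↔ ((∃ w ∈ C, ∃ y ∈ J, w ≤ y) ∧ ∃ w ∈ C, ∃ y ∈ J, ¬ w ≤ y) :=
    ⟨_, fun _ => Iff.rfl⟩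
  obtain ⟨MB, hMB⟩ : ∃ M : Finset X → Prop, ∀ C, M C ↔ ((∃ w ∈ C, ∃ y ∈ J, y ≤ w) ∧ ∃ w ∈ C, ∃ y ∈ J, ¬ y ≤ w) :=
    ⟨_, fun _ => Iff.rfl⟩
  let GA : Fin d → Finset (Finset X) := fun i =>
    (Finset.univ.filter (fun z => c z = i ∧ MA (blk c T z))).image (blk c T)
  let GB : Fin d → Finset (Finset X) := fun i =>
    (Finset.univ.filter (fun z => c z = i ∧ MB (blk c T z))).image (blk c T)
  have hA : ∀ i, (GA i).card ≤ 1 + (T.filter (fun t => c t = i ∧ CutA p J t)).card := by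
    intro i
    refine card_blocks_le hc T i MA (CutA p J) ?_
    intro C₀ C hC₀ hC
    rw [hMA] at hC₀ hC
    revert hC₀ hC
    rintro ⟨-, w', hw', y', hy', hn⟩ ⟨⟨w, hw, y, hy, hle⟩, -⟩ t ht h1 h2
    exact ⟨⟨y', hy', fun h => hn ((h2 w' hw').le.trans h)⟩,
      ⟨y, hy, (hp t ht).1.le.trans ((h1 w hw).trans hle)⟩⟩
  have hB : ∀ i, (GB i).card ≤ 1 + (T.filter (fun t => c t = i ∧ CutB p J t)).card := by
    intro i
    refine card_blocks_le hc T i MB (CutB p J) ?_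
    intro C₀ C hC₀ hC
    rw [hMB] at hC₀ hC
    revert hC₀ hC
    rintro ⟨⟨w, hw, y, hy, hle⟩, -⟩ ⟨-, w', hw', y', hy', hn⟩ t ht h1 h2
    exact ⟨⟨y, hy, hle.trans (h2 w hw).le⟩,
      ⟨y', hy', fun h => hn (h.trans ((hp t ht).1.le.trans (h1 w' hw')))⟩⟩
  have hsub : redDeg (· ≤ ·) (parts c T) (blk c T x) ≤
      ((Finset.univ.erase (c x)).biUnion (fun i => GA i ∪ GB i)).card := by
    unfold redDeg
    apply Finset.card_le_card
    intro C hC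
    simp only [Finset.mem_filter] at hC
    obtain ⟨hCP, hCne, hn1, hn2, y, hy, w, hw, hyw⟩ := hC
    obtain ⟨z, -, rfl⟩ := Finset.mem_image.1 hCP
    have hcz : c z ≠ c x := by
      intro hczx
      rcases hc z x hczx with hle | hle
      · obtain ⟨t, -, -, -, h1, h2⟩ := exists_start hc hczx hle (Ne.symm hCne)
        exact hn2 (fun a ha b hb => (h2 a ha).le.trans (h1 b hb))
      · obtain ⟨t, -, -, -, h1, h2⟩ := exists_start hc hczx.symm hle hCne
        exact hn1 (fun a ha b hb => (h2 a ha).le.trans (h1 b hb))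
    simp only [blockLE, not_forall] at hn1 hn2
    obtain ⟨a, ha, b, hb, hab⟩ := hn1
    obtain ⟨a', ha', b', hb', hab'⟩ := hn2
    refine Finset.mem_biUnion.2 ⟨c z, by simp [hcz], ?_⟩
    rw [Finset.mem_union]
    rcases hyw with h | h
    · right
      exact Finset.mem_image.2 ⟨z, Finset.mem_filter.2 ⟨Finset.mem_univ z, rfl,
        (hMB _).2 ⟨⟨w, hw, y, hy, h⟩, ⟨b, hb, a, ha, hab⟩⟩⟩, rfl⟩
    · left
      exact Finset.mem_image.2 ⟨z, Finset.mem_filter.2 ⟨Finset.mem_univ z, rfl,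
        (hMA _).2 ⟨⟨w, hw, y, hy, h⟩, ⟨a', ha', b', hb', hab'⟩⟩⟩, rfl⟩
  refine hsub.trans (Finset.card_biUnion_le.trans ?_)
  unfold touch
  rw [card_split, card_split]
  calc _ ≤ ∑ i ∈ Finset.univ.erase (c x), (2 + ((T.filter (fun t => c t = i ∧ CutA p J t)).card +
          (T.filter (fun t => c t = i ∧ CutB p J t)).card)) := by
        apply Finset.sum_le_sum
        intro i _
        have h1 := hA i
        have h2 := hB i
        have h3 := Finset.card_union_le (GA i) (GB i)
        omega
    _ = _ := by
        rw [Finset.sum_add_distrib, Finset.sum_add_distrib]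
        simp [mul_comm, J]

/-- Removing a cut merges two blocks. -/
theorem parts_merge {c : X → Fin d} (hc : ∀ x y, c x = c y → x ≤ y ∨ y ≤ x) {p : X → X}
    {T : Finset X} (hp : IsPred c p T) {s : X} (hs : s ∈ T) :
    MergeStep (parts c T) (parts c (T.erase s)) ∧
    ∀ x, x ∉ blk c (T.erase s) s → blk c (T.erase s) x = blk c T x := by
  obtain ⟨hps, hcp, hpm⟩ := hp s hs
  have hother : ∀ x, x ∉ blk c (T.erase s) s → blk c (T.erase s) x = blk c T x := by
    intro x hx
    ext y
    rw [mem_blk, mem_blk]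
    refine ⟨fun ⟨h1, h2⟩ => ⟨h1, fun t ht hct => ?_⟩,
      fun ⟨h1, h2⟩ => ⟨h1, fun t ht hct => h2 t (Finset.mem_of_mem_erase ht) hct⟩⟩
    by_cases hts : t = s
    swap
    · exact h2 t (Finset.mem_erase.2 ⟨hts, ht⟩) hct
    subst hts
    by_contra hcon
    apply hx
    -- `t` separates `x` and `y` but no other cut does
    rw [mem_blk]
    refine ⟨hct.symm, fun u hu hcu => ?_⟩
    have hux := h2 u hu (hcu.trans hct)
    have hut : u ≠ t := Finset.ne_of_mem_erase hu
    have aux : ∀ a b : X, c a = c t → c b = c t → t ≤ a → ¬ t ≤ b → (u ≤ a ↔ u ≤ b) →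
        ((u ≤ t ↔ u ≤ a) ∧ (u ≤ t ↔ u ≤ b)) := by
      intro a b hca hcb hta htb hab
      have hbt : b < t := lt_of_not_le hc hcb.symm htb
      have : u ≤ t ↔ u ≤ a := by
        refine ⟨fun h => h.trans hta, fun h => (hab.1 h).trans hbt.le⟩
      exact ⟨this, this.trans hab⟩
    by_cases htx : t ≤ x
    · have hty : ¬ t ≤ y := fun h => hcon ⟨fun _ => h, fun _ => htx⟩
      exact (aux x y hct.symm (h1.trans hct.symm) htx hty hux).1
    · have hty : t ≤ y := by
        by_contra h; exact hcon ⟨fun h' => absurd h' htx, fun h' => absurd h' h⟩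
      exact (aux y x (h1.trans hct.symm) hct.symm hty htx hux.symm).2
  refine ⟨?_, hother⟩
  have hunion : blk c (T.erase s) s = blk c T s ∪ blk c T (p s) := by
    ext y
    rw [Finset.mem_union, mem_blk, mem_blk, mem_blk, hcp]
    constructor
    · rintro ⟨h1, h2⟩
      by_cases hsy : s ≤ y
      · left
        refine ⟨h1, fun t ht hct => ?_⟩
        by_cases hts : t = s
        · subst hts; simp [hsy]
        · exact h2 t (Finset.mem_erase.2 ⟨hts, ht⟩) hct
      · right
        refine ⟨h1, fun t ht hct => ?_⟩
        by_cases hts : t = s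
        · subst hts
          exact ⟨fun h => absurd h (not_le_of_gt hps), fun h => absurd h hsy⟩
        · rw [← h2 t (Finset.mem_erase.2 ⟨hts, ht⟩) hct]
          exact ⟨fun h => h.trans hps.le, fun h => hpm t hct (lt_of_le_of_ne h hts)⟩
    · rintro (⟨h1, h2⟩ | ⟨h1, h2⟩)
      · exact ⟨h1, fun t ht hct => h2 t (Finset.mem_of_mem_erase ht) hct⟩
      · refine ⟨h1, fun t ht hct => ?_⟩
        rw [← h2 t (Finset.mem_of_mem_erase ht) hct]
        exact ⟨fun h => hpm t hct (lt_of_le_of_ne h (Finset.ne_of_mem_erase ht)),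
          fun h => h.trans hps.le⟩
  have hmem : ∀ x, blk c T x ∈ parts c T := fun x => Finset.mem_image_of_mem _ (Finset.mem_univ x)
  refine ⟨blk c T s, hmem s, blk c T (p s), hmem _, ?_, ?_⟩
  · intro h
    have h1 : p s ∈ blk c T s := by rw [h]; exact self_mem_blk c T _
    exact not_le_of_gt hps (((mem_blk.1 h1).2 s hs rfl).1 le_rfl)
  · ext C
    rw [← hunion, Finset.mem_insert, Finset.mem_erase, Finset.mem_erase]
    constructor
    · intro hC
      obtain ⟨x, -, rfl⟩ := Finset.mem_image.1 hC
      by_cases hx : x ∈ blk c (T.erase s) s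
      · left; exact blk_eq hx
      · right
        rw [hother x hx]
        rw [hunion, Finset.mem_union, not_or] at hx
        refine ⟨fun h => hx.2 ?_, fun h => hx.1 ?_, hmem x⟩
        · rw [← h]; exact self_mem_blk c T x
        · rw [← h]; exact self_mem_blk c T x
    · rintro (rfl | ⟨h1, h2, h3⟩)
      · exact Finset.mem_image_of_mem _ (Finset.mem_univ s)
      · obtain ⟨x, -, rfl⟩ := Finset.mem_image.1 h3
        have hx : x ∉ blk c (T.erase s) s := by
          rw [hunion, Finset.mem_union, not_or]
          exact ⟨fun h => h2 (blk_eq h), fun h => h1 (blk_eq h)⟩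
        rw [← hother x hx]
        exact Finset.mem_image_of_mem _ (Finset.mem_univ x)

theorem cseq_of_cuts [Nonempty X] {c : X → Fin d} (hd : 2 ≤ d)
    (hc : ∀ x y, c x = c y → x ≤ y ∨ y ≤ x)
    {p : X → X} (m : ℕ) : ∀ T : Finset X, T.card = m → IsPred c p T →
      (∀ x, touch c p T (c x) (blk c T x) ≤ 6 * (d - 1)) →
      CSeq (· ≤ ·) (9 * d - 6) (parts c T) := by
  induction m with
  | zero =>
    intro T hT hp _
    have hT0 : T = ∅ := by simpa using hT
    subst hT0
    apply CSeq.of_small _ _ _ _ (parts_partition c ∅) _ rfl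
    have : (parts c (∅ : Finset X)).card ≤ d := by
      classical
      have hsub : parts c (∅ : Finset X) ⊆
          Finset.univ.image (fun i : Fin d => Finset.univ.filter (fun y => c y = i)) := by
        intro C hC
        obtain ⟨x, -, rfl⟩ := Finset.mem_image.1 hC
        refine Finset.mem_image.2 ⟨c x, Finset.mem_univ _, ?_⟩
        ext y; simp [mem_blk]
      calc _ ≤ _ := Finset.card_le_card hsub
        _ ≤ _ := Finset.card_image_le
        _ = d := by simp
    omega
  | succ m ih =>
    intro T hT hp htouch
    have hred : ∀ B ∈ parts c T, redDeg (· ≤ ·) (parts c T) B ≤ 9 * d - 6 := by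
      intro B hB
      obtain ⟨x, -, rfl⟩ := Finset.mem_image.1 hB
      have h1 := redDeg_le hc hp x
      have h2 := htouch x
      omega
    have hne : T.Nonempty := Finset.card_pos.1 (by omega)
    obtain ⟨s, hs, hle⟩ : ∃ s ∈ T, touch c p T (c s) (blk c (T.erase s) s) ≤ 6 * (d - 1) := by
      apply Finset.exists_le_of_sum_le hne
      refine (sum_touch hc hp).trans ?_
      simp [mul_comm]
    obtain ⟨hM, hother⟩ := parts_merge hc hp hs
    refine CSeq.step _ _ (parts_partition c T) hred hM (ih (T.erase s) ?_ ?_ ?_)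
    · rw [Finset.card_erase_of_mem hs]; omega
    · exact fun t ht => hp t (Finset.mem_of_mem_erase ht)
    · intro x
      refine (touch_mono (Finset.erase_subset s T) _ _).trans ?_
      by_cases hx : x ∈ blk c (T.erase s) s
      · rw [blk_eq hx, (mem_blk.1 hx).1]; exact hle
      · rw [hother x hx]; exact htouch x

theorem upper_bound [Nonempty X] (hd : 2 ≤ d)
    (h : ∀ A : Finset X, IsAntichain (· ≤ ·) (A : Set X) → A.card ≤ d) :
    NatTwinWidthLE (· ≤ ·) (X := X) (9 * d - 6) := by
  classical
  obtain ⟨c, hc⟩ := dilworth_fin d h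
  let T : Finset X := Finset.univ.filter (fun t => ∃ x, c x = c t ∧ x < t)
  have hpred : ∀ t, ∃ q, t ∈ T → q < t ∧ c q = c t ∧ ∀ x, c x = c t → x < t → x ≤ q := by
    intro t
    by_cases ht : t ∈ T
    swap
    · exact ⟨t, fun h => absurd h ht⟩
    obtain ⟨-, x, hx⟩ := Finset.mem_filter.1 ht
    obtain ⟨q, hq, hqm⟩ := (Finset.univ.filter (fun x => c x = c t ∧ x < t)).exists_maximal
      ⟨x, Finset.mem_filter.2 ⟨Finset.mem_univ x, hx⟩⟩
    obtain ⟨-, hq1, hq2⟩ := Finset.mem_filter.1 hq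
    refine ⟨q, fun _ => ⟨hq2, hq1, fun y hy hyt => ?_⟩⟩
    exact (hc y q (hy.trans hq1.symm)).elim id
      (fun h => hqm (Finset.mem_filter.2 ⟨Finset.mem_univ y, hy, hyt⟩) h)
  choose p hp using hpred
  have hblk : ∀ x, blk c T x = {x} := by
    intro x
    ext y
    rw [Finset.mem_singleton]
    refine ⟨fun hy => ?_, fun hy => hy ▸ self_mem_blk c T x⟩
    obtain ⟨h1, h2⟩ := mem_blk.1 hy
    by_contra hne
    rcases hc y x h1 with hle | hle
    · have hlt := lt_of_le_of_ne hle hne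
      have hx : x ∈ T := Finset.mem_filter.2 ⟨Finset.mem_univ x, y, h1, hlt⟩
      exact not_le_of_gt hlt ((h2 x hx rfl).1 le_rfl)
    · have hlt := lt_of_le_of_ne hle (Ne.symm hne)
      have hy : y ∈ T := Finset.mem_filter.2 ⟨Finset.mem_univ y, x, h1.symm, hlt⟩
      exact not_le_of_gt hlt ((h2 y hy h1).2 le_rfl)
  have hseq := cseq_of_cuts hd hc (p := p) _ T rfl hp (by
    intro x
    rw [hblk]
    have := touch_singleton hc (p := p) hp (c x) x
    omega)
  have hparts : parts c T = Finset.univ.image (fun x => ({x} : Finset X)) := by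
    unfold parts
    congr 1
    funext x
    exact hblk x
  rw [hparts] at hseq
  exact hseq.exists_seq

end blocks

/-- The worst-case natural twin-width of posets of width `d ≥ 2` is `Θ(d)`:
some poset of width `d` has natural twin-width at least `d − 1` (not at most
`d − 2`), while every finite poset of width `d` has natural twin-width at most
`9d − 6`. -/
theorem stmt17 (d : ℕ) (hd : 2 ≤ d) :
    (∃ (n : ℕ) (le : Fin n → Fin n → Prop),
      IsPartialOrder (Fin n) le ∧
      (∀ A : Finset (Fin n),
        (∀ x ∈ A, ∀ y ∈ A, x ≠ y → ¬ le x y ∧ ¬ le y x) → A.card ≤ d) ∧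
      (∃ A : Finset (Fin n),
        (∀ x ∈ A, ∀ y ∈ A, x ≠ y → ¬ le x y ∧ ¬ le y x) ∧ A.card = d) ∧
      ¬ NatTwinWidthLE le (d - 2)) ∧
    (∀ (X : Type) [Fintype X] [DecidableEq X] [Nonempty X] [PartialOrder X],
      (∀ A : Finset X, IsAntichain (· ≤ ·) (A : Set X) → A.card ≤ d) →
      (∃ A : Finset X, IsAntichain (· ≤ ·) (A : Set X) ∧ A.card = d) →
      NatTwinWidthLE (· ≤ ·) (X := X) (9 * d - 6)) := by
  refine ⟨lower_bound d hd, ?_⟩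
  intro X _ _ _ _ h _
  exact upper_bound hd h
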